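/- arXiv:1207.5780 — 2 statements merged into one kernel-verified Lean document; each statement's English description precedes it below -/
import Mathlib

section
/- If a ∈ A satisfies a · t_i = t_i · a for all i ∈ I, then a ∈ A_0. In particular, A_0 is a maximal commutative subalgebra of A. -/
set_option synthInstance.maxHeartbeats 1000000
set_option maxHeartbeats 4000000

noncomputable section

open MvPolynomial

universe u v

variable (k : Type u) (I : Type v) [Field k]

/-- Multiplication by the variable `x i` on the polynomial algebra `B`. -/
def Xop (i : I) : Module.End k (MvPolynomial I k) :=
  LinearMap.mulLeft k (MvPolynomial.X i)

/-- The partial derivative `∂/∂x i` on the polynomial algebra `B`. -/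
def Yop (i : I) : Module.End k (MvPolynomial I k) :=
  (MvPolynomial.pderiv i).toLinearMap

/-- The infinite Weyl algebra `A`: the subalgebra of `Module.End k B` generated by
all `X i` and `Y i`. -/
def Weyl : Subalgebra k (Module.End k (MvPolynomial I k)) :=
  Algebra.adjoin k (Set.range (Xop k I) ∪ Set.range (Yop k I))

instance : Ring (Weyl k I) := inferInstance
instance : Algebra k (Weyl k I) := inferInstance

/-- `X i` as an element of the Weyl algebra. -/
def XA (i : I) : Weyl k I :=
  ⟨Xop k I i, Algebra.subset_adjoin (Set.mem_union_left _ ⟨i, rfl⟩)⟩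

/-- `Y i` as an element of the Weyl algebra. -/
def YA (i : I) : Weyl k I :=
  ⟨Yop k I i, Algebra.subset_adjoin (Set.mem_union_right _ ⟨i, rfl⟩)⟩

/-- `t i = X i * Y i` as an element of the Weyl algebra. -/
def tA (i : I) : Weyl k I := XA k I i * YA k I i

/-- The subalgebra `A₀` of the Weyl algebra generated by the `t i`. -/
def A0 : Subalgebra k (Weyl k I) := Algebra.adjoin k (Set.range (tA k I))

section

variable {k I}

/-- The coefficient of a polynomial at an integer exponent vector, zero unless all the
exponents are natural numbers. -/
def intCoeff (f : MvPolynomial I k) (z : I → ℤ) : k :=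
  Function.extend (fun (n : I →₀ ℕ) (i : I) => (n i : ℤ)) (fun n => coeff n f) 0 z

theorem natCast_exponent_injective :
    Function.Injective (fun (n : I →₀ ℕ) (i : I) => (n i : ℤ)) := fun n m h => by
  ext i
  exact Nat.cast_injective (congrFun h i)

theorem intCoeff_natCast (f : MvPolynomial I k) (n : I →₀ ℕ) :
    intCoeff f (fun i => (n i : ℤ)) = coeff n f :=
  natCast_exponent_injective.extend_apply _ _ n

theorem intCoeff_of_not_exists (f : MvPolynomial I k) {z : I → ℤ}
    (hz : ¬∃ n : I →₀ ℕ, (fun i => (n i : ℤ)) = z) : intCoeff f z = 0 :=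
  Function.extend_apply' _ _ _ hz

theorem intCoeff_add (f g : MvPolynomial I k) (z : I → ℤ) :
    intCoeff (f + g) z = intCoeff f z + intCoeff g z := by
  by_cases hz : ∃ n : I →₀ ℕ, (fun i => (n i : ℤ)) = z
  · obtain ⟨n, rfl⟩ := hz
    simp only [intCoeff_natCast, coeff_add]
  · simp only [intCoeff_of_not_exists _ hz, add_zero]

theorem intCoeff_smul (c : k) (f : MvPolynomial I k) (z : I → ℤ) :
    intCoeff (c • f) z = c * intCoeff f z := by
  by_cases hz : ∃ n : I →₀ ℕ, (fun i => (n i : ℤ)) = z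
  · obtain ⟨n, rfl⟩ := hz
    simp only [intCoeff_natCast, coeff_smul, smul_eq_mul]
  · simp only [intCoeff_of_not_exists _ hz, mul_zero]

theorem mul_intCoeff_add_single_eq_zero [DecidableEq I] (f : MvPolynomial I k) {z : I → ℤ}
    (hz : ¬∃ n : I →₀ ℕ, (fun i => (n i : ℤ)) = z) (i : I) :
    ((z i : k) + 1) * intCoeff f (z + Pi.single i 1) = 0 := by
  by_cases hz' : ∃ n : I →₀ ℕ, (fun j => (n j : ℤ)) = z + Pi.single i 1
  · obtain ⟨n, hn⟩ := hz'
    have hi : (n i : ℤ) = z i + 1 := by simpa using congrFun hn i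
    rcases Nat.eq_zero_or_pos (n i) with h0 | hpos
    · have : z i = -1 := by rw [h0] at hi; push_cast at hi; linarith
      simp [this]
    · refine absurd ⟨n - Finsupp.single i 1, ?_⟩ hz
      ext j
      have hj : (n j : ℤ) = z j + (Pi.single i 1 : I → ℤ) j := congrFun hn j
      by_cases hij : j = i
      · subst hij
        simp only [Finsupp.coe_tsub, Pi.sub_apply, Finsupp.single_eq_same]
        omega
      · simpa [hij] using hj
  · rw [intCoeff_of_not_exists _ hz', mul_zero]

theorem intCoeff_Xop [DecidableEq I] (i : I) (f : MvPolynomial I k) (z : I → ℤ) :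
    intCoeff (Xop k I i f) z = intCoeff f (z - Pi.single i 1) := by
  have hX : Xop k I i f = X i * f := rfl
  rw [hX]
  by_cases hz' : ∃ n : I →₀ ℕ, (fun j => (n j : ℤ)) = z - Pi.single i 1
  · obtain ⟨n, hn⟩ := hz'
    have hz : z = fun j => ((Finsupp.single i 1 + n : I →₀ ℕ) j : ℤ) := by
      ext j
      have hj : (n j : ℤ) = z j - (Pi.single i 1 : I → ℤ) j := congrFun hn j
      by_cases hij : j = i
      · subst hij
        simp at hj ⊢
        omega
      · simpa [hij, Ne.symm hij] using hj.symm
    rw [← hn, intCoeff_natCast, hz, intCoeff_natCast, coeff_X_mul]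
  · rw [intCoeff_of_not_exists _ hz']
    by_cases hz : ∃ n : I →₀ ℕ, (fun j => (n j : ℤ)) = z
    · obtain ⟨n, rfl⟩ := hz
      rw [intCoeff_natCast, coeff_X_mul', if_neg]
      intro hi
      have hi' : n i ≠ 0 := Finsupp.mem_support_iff.mp hi
      refine hz' ⟨n - Finsupp.single i 1, ?_⟩
      ext j
      by_cases hij : j = i
      · subst hij
        simp only [Finsupp.coe_tsub, Pi.sub_apply, Finsupp.single_eq_same, Pi.single_eq_same]
        omega
      · simp [hij]
    · exact intCoeff_of_not_exists _ hz

theorem coeff_pderiv_eq (i : I) (f : MvPolynomial I k) (n : I →₀ ℕ) :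
    coeff n (pderiv i f) = ((n i : k) + 1) * coeff (n + Finsupp.single i 1) f := by
  classical
  induction f using MvPolynomial.induction_on' with
  | monomial m c =>
    rw [pderiv_monomial, coeff_monomial, coeff_monomial]
    by_cases h : m = n + Finsupp.single i 1
    · subst h
      simp [mul_comm]
    · rw [if_neg h, mul_zero]
      split_ifs with h'
      · have : m i = 0 := by
          by_contra hmi
          apply h
          rw [← h', tsub_add_cancel_of_le]
          simpa [Nat.one_le_iff_ne_zero] using hmi
        simp [this]
      · rfl
  | add p q hp hq => simp only [map_add, coeff_add, hp, hq, mul_add]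

theorem intCoeff_Yop [DecidableEq I] (i : I) (f : MvPolynomial I k) (z : I → ℤ) :
    intCoeff (Yop k I i f) z = ((z i : k) + 1) * intCoeff f (z + Pi.single i 1) := by
  have hY : Yop k I i f = pderiv i f := rfl
  rw [hY]
  by_cases hz : ∃ n : I →₀ ℕ, (fun j => (n j : ℤ)) = z
  · obtain ⟨n, rfl⟩ := hz
    have hn : (fun j => (n j : ℤ)) + Pi.single i 1 =
        fun j => ((n + Finsupp.single i 1 : I →₀ ℕ) j : ℤ) := by
      ext j
      by_cases hij : j = i
      · subst hij; simp
      · simp [hij]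
    rw [hn, intCoeff_natCast, intCoeff_natCast, coeff_pderiv_eq]
    simp
  · rw [intCoeff_of_not_exists _ hz, mul_intCoeff_add_single_eq_zero f hz]

variable (k I) in
/-- Operators on `B` whose matrix coefficient from `x ^ m` to `x ^ (m + w)` is, for every
integer weight `w`, a polynomial function of `m`. -/
def polynomialCoeffOperators : Submodule k (Module.End k (MvPolynomial I k)) where
  carrier := {a | ∀ w : I → ℤ, ∃ P : MvPolynomial I k, ∀ m : I →₀ ℕ,
    intCoeff (a (monomial m 1)) ((fun i => (m i : ℤ)) + w) = eval (fun i => (m i : k)) P}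
  add_mem' := fun {a b} ha hb w => by
    obtain ⟨P, hP⟩ := ha w
    obtain ⟨Q, hQ⟩ := hb w
    refine ⟨P + Q, fun m => ?_⟩
    rw [LinearMap.add_apply, intCoeff_add, hP, hQ, eval_add]
  zero_mem' := fun w => ⟨0, fun m => by
    have h0 := intCoeff_smul (0 : k) (0 : MvPolynomial I k) ((fun i => (m i : ℤ)) + w)
    rw [zero_smul, zero_mul] at h0
    rw [LinearMap.zero_apply, h0, map_zero]⟩
  smul_mem' := fun c a ha w => by
    obtain ⟨P, hP⟩ := ha w
    refine ⟨C c * P, fun m => ?_⟩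
    rw [LinearMap.smul_apply, intCoeff_smul, hP, eval_mul, eval_C]

theorem one_mem_polynomialCoeffOperators : 1 ∈ polynomialCoeffOperators k I := by
  classical
  intro w
  refine ⟨if w = 0 then 1 else 0, fun m => ?_⟩
  rw [Module.End.one_apply]
  by_cases hw : w = 0
  · rw [if_pos hw, hw, add_zero, intCoeff_natCast, coeff_monomial, if_pos rfl, map_one]
  · rw [if_neg hw, map_zero]
    by_cases hz : ∃ n : I →₀ ℕ, (fun i => (n i : ℤ)) = (fun i => (m i : ℤ)) + w
    · obtain ⟨n, hn⟩ := hz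
      rw [← hn, intCoeff_natCast, coeff_monomial, if_neg]
      rintro rfl
      exact hw (left_eq_add.mp hn)
    · exact intCoeff_of_not_exists _ hz

theorem Xop_mul_mem_polynomialCoeffOperators (i : I) {a : Module.End k (MvPolynomial I k)}
    (ha : a ∈ polynomialCoeffOperators k I) : Xop k I i * a ∈ polynomialCoeffOperators k I := by
  classical
  intro w
  obtain ⟨P, hP⟩ := ha (w - Pi.single i 1)
  refine ⟨P, fun m => ?_⟩
  rw [Module.End.mul_apply, intCoeff_Xop, add_sub_assoc, hP]

theorem Yop_mul_mem_polynomialCoeffOperators (i : I) {a : Module.End k (MvPolynomial I k)}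
    (ha : a ∈ polynomialCoeffOperators k I) : Yop k I i * a ∈ polynomialCoeffOperators k I := by
  classical
  intro w
  obtain ⟨P, hP⟩ := ha (w + Pi.single i 1)
  refine ⟨(X i + C ((w i : k) + 1)) * P, fun m => ?_⟩
  rw [Module.End.mul_apply, intCoeff_Yop, add_assoc, hP]
  simp [add_assoc]

theorem mem_polynomialCoeffOperators_of_mem_Weyl {a : Module.End k (MvPolynomial I k)}
    (ha : a ∈ Weyl k I) : a ∈ polynomialCoeffOperators k I := by
  suffices h : ∀ b ∈ polynomialCoeffOperators k I, a * b ∈ polynomialCoeffOperators k I by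
    simpa using h 1 one_mem_polynomialCoeffOperators
  unfold Weyl at ha
  induction ha using Algebra.adjoin_induction with
  | mem x hx =>
    intro b hb
    rcases hx with ⟨i, rfl⟩ | ⟨i, rfl⟩
    · exact Xop_mul_mem_polynomialCoeffOperators i hb
    · exact Yop_mul_mem_polynomialCoeffOperators i hb
  | algebraMap c =>
    intro b hb
    rw [← Algebra.smul_def]
    exact Submodule.smul_mem _ c hb
  | add x y _ _ hx hy =>
    intro b hb
    rw [add_mul]
    exact Submodule.add_mem _ (hx b hb) (hy b hb)
  | mul x y _ _ hx hy =>
    intro b hb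
    rw [mul_assoc]
    exact hx _ (hy b hb)

theorem tA_apply (i : I) (f : MvPolynomial I k) :
    (tA k I i : Module.End k (MvPolynomial I k)) f = X i * pderiv i f := rfl

theorem coeff_tA_apply (i : I) (f : MvPolynomial I k) (n : I →₀ ℕ) :
    coeff n ((tA k I i : Module.End k (MvPolynomial I k)) f) = (n i : k) * coeff n f := by
  classical
  rw [tA_apply, coeff_X_mul']
  split_ifs with hi
  · have hi' : n i ≠ 0 := Finsupp.mem_support_iff.mp hi
    have hle : Finsupp.single i 1 ≤ n := by simpa [Nat.one_le_iff_ne_zero] using hi'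
    rw [coeff_pderiv_eq, tsub_add_cancel_of_le hle]
    congr 1
    rw [Finsupp.tsub_apply, Finsupp.single_eq_same]
    rw [← Nat.cast_add_one, Nat.sub_add_cancel (Nat.one_le_iff_ne_zero.mpr hi')]
  · rw [Finsupp.notMem_support_iff.mp hi, Nat.cast_zero, zero_mul]

theorem tA_apply_monomial (i : I) (m : I →₀ ℕ) :
    (tA k I i : Module.End k (MvPolynomial I k)) (monomial m 1) =
      (m i : k) • monomial m 1 := by
  classical
  ext n
  rw [coeff_tA_apply, coeff_smul, coeff_monomial, smul_eq_mul]
  split_ifs with h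
  · rw [h]
  · simp

theorem exists_mem_A0_apply_monomial (P : MvPolynomial I k) :
    ∃ b ∈ A0 k I, ∀ m : I →₀ ℕ, (b : Module.End k (MvPolynomial I k)) (monomial m 1) =
      eval (fun i => (m i : k)) P • monomial m 1 := by
  induction P using MvPolynomial.induction_on with
  | C c =>
    refine ⟨algebraMap k _ c, Subalgebra.algebraMap_mem _ c, fun m => ?_⟩
    rw [eval_C]
    rfl
  | add p q hp hq =>
    obtain ⟨b, hb, hbm⟩ := hp
    obtain ⟨b', hb', hbm'⟩ := hq
    refine ⟨b + b', add_mem hb hb', fun m => ?_⟩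
    rw [eval_add, add_smul, ← hbm, ← hbm']
    rfl
  | mul_X p i hp =>
    obtain ⟨b, hb, hbm⟩ := hp
    refine ⟨b * tA k I i, mul_mem hb (Algebra.subset_adjoin ⟨i, rfl⟩), fun m => ?_⟩
    have hmul : ((b * tA k I i : Weyl k I) : Module.End k (MvPolynomial I k)) (monomial m 1) =
        (b : Module.End k (MvPolynomial I k))
          ((tA k I i : Module.End k (MvPolynomial I k)) (monomial m 1)) := rfl
    rw [hmul, tA_apply_monomial, map_smul, hbm, smul_smul, eval_mul, eval_X, mul_comm]

theorem apply_monomial_of_commutes_with_t [CharZero k] {a : Weyl k I}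
    (h : ∀ i, a * tA k I i = tA k I i * a) (m : I →₀ ℕ) :
    (a : Module.End k (MvPolynomial I k)) (monomial m 1) =
      coeff m ((a : Module.End k (MvPolynomial I k)) (monomial m 1)) • monomial m 1 := by
  classical
  ext n
  rw [coeff_smul, coeff_monomial, smul_eq_mul]
  split_ifs with hmn
  · rw [hmn, mul_one]
  · rw [mul_zero]
    obtain ⟨i, hi⟩ := DFunLike.ne_iff.mp hmn
    have hcomm : (a : Module.End k (MvPolynomial I k))
        ((tA k I i : Module.End k (MvPolynomial I k)) (monomial m 1)) =
        (tA k I i : Module.End k (MvPolynomial I k))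
          ((a : Module.End k (MvPolynomial I k)) (monomial m 1)) :=
      congrArg (fun c : Weyl k I => (c : Module.End k (MvPolynomial I k)) (monomial m 1)) (h i)
    have hcoeff := congrArg (coeff n) hcomm
    rw [tA_apply_monomial, map_smul, coeff_smul, coeff_tA_apply, smul_eq_mul] at hcoeff
    exact (mul_eq_mul_right_iff.mp hcoeff).resolve_left (by exact_mod_cast hi)

end

/-- Any element of the Weyl algebra commuting with all `t i` lies in `A₀`;
in particular `A₀` is a maximal commutative subalgebra. -/
theorem mem_A0_of_commutes_with_t [IsAlgClosed k] [CharZero k] [Infinite I]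
    (a : Weyl k I) (h : ∀ i, a * tA k I i = tA k I i * a) : a ∈ A0 k I := by
  obtain ⟨P, hP⟩ := mem_polynomialCoeffOperators_of_mem_Weyl a.2 0
  obtain ⟨b, hb, hbm⟩ := exists_mem_A0_apply_monomial P
  suffices hab : a = b from hab ▸ hb
  refine Subtype.ext ((basisMonomials I k).ext fun m => ?_)
  rw [coe_basisMonomials, hbm, apply_monomial_of_commutes_with_t h, ← hP, add_zero,
    intCoeff_natCast]
end
end

section
/- N and N'' are A-submodules of B(p), and the quotient module L(p) := N/N'' is a simple A-module; moreover the image of e_0 in N/N'' is nonzero, so the weight space (N/N'')_p is nonzero. -/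
set_option synthInstance.maxHeartbeats 1000000
set_option maxHeartbeats 4000000

noncomputable section

open MvPolynomial

universe u v

variable (k : Type u) (I : Type v) [Field k]

/-- The shift operator `S i : e_v ↦ e_{v + δ i}` on the free module `(I →₀ ℤ) →₀ k`. -/
def Sop (i : I) : Module.End k ((I →₀ ℤ) →₀ k) :=
  Finsupp.lmapDomain k k (fun v => v + Finsupp.single i 1)

/-- The twisted derivative operator `D i : e_v ↦ (p i + v i) • e_{v - δ i}`. -/
def Dop (p : I → k) (i : I) : Module.End k ((I →₀ ℤ) →₀ k) :=
  Finsupp.lsum k fun v =>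
    LinearMap.toSpanSingleton k ((I →₀ ℤ) →₀ k)
      ((p i + ((v i : ℤ) : k)) • Finsupp.single (v - Finsupp.single i 1) (1 : k))

/-- The space `V = (I →₀ ℤ) →₀ k` regarded as a module over the Weyl algebra through a
homomorphism `ρ : A →ₐ[k] End_k V`; this is the module `B(p)` when `ρ = ρ_p`. -/
def BMod (ρ : Weyl k I →ₐ[k] Module.End k ((I →₀ ℤ) →₀ k)) : Type (max u v) :=
  (I →₀ ℤ) →₀ k

variable {k I} in
instance (ρ : Weyl k I →ₐ[k] Module.End k ((I →₀ ℤ) →₀ k)) : AddCommGroup (BMod k I ρ) :=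
  inferInstanceAs (AddCommGroup ((I →₀ ℤ) →₀ k))

variable {k I} in
instance (ρ : Weyl k I →ₐ[k] Module.End k ((I →₀ ℤ) →₀ k)) : Module k (BMod k I ρ) :=
  inferInstanceAs (Module k ((I →₀ ℤ) →₀ k))

variable {k I} in
instance (ρ : Weyl k I →ₐ[k] Module.End k ((I →₀ ℤ) →₀ k)) :
    Module (Weyl k I) (BMod k I ρ) where
  smul a x := ρ a x
  one_smul x := by show ρ 1 x = x; rw [map_one]; rfl
  mul_smul a b x := by show ρ (a * b) x = ρ a (ρ b x); rw [map_mul]; rfl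
  smul_zero a := map_zero (ρ a)
  smul_add a x y := map_add (ρ a) x y
  add_smul a b x := by show ρ (a + b) x = ρ a x + ρ b x; rw [map_add]; rfl
  zero_smul x := by show ρ 0 x = 0; rw [map_zero]; rfl

variable {k I} in
instance (ρ : Weyl k I →ₐ[k] Module.End k ((I →₀ ℤ) →₀ k)) :
    IsScalarTower k (Weyl k I) (BMod k I ρ) :=
  ⟨fun c a x => by
    show ρ (c • a) x = c • (ρ a x)
    rw [map_smul]
    rfl⟩

/-- The basis vector `e_v` of `B(p)`. -/
def eV (ρ : Weyl k I →ₐ[k] Module.End k ((I →₀ ℤ) →₀ k)) (v : I →₀ ℤ) : BMod k I ρ :=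
  Finsupp.single v 1

/-- `c` is a nonnegative integer. -/
def IsNonnegInt (c : k) : Prop := ∃ n : ℕ, c = n

/-- `c` is a negative integer. -/
def IsNegInt (c : k) : Prop := ∃ m : ℤ, m < 0 ∧ c = m

/-- The index set `S` of the submodule `N ⊆ B(p)`. -/
def Sset (p : I → k) : Set (I →₀ ℤ) :=
  {v | ∀ i, IsNonnegInt k (p i) → IsNonnegInt k (p i + ((v i : ℤ) : k))}

/-- The index set `S''` of the submodule `N'' ⊆ N`. -/
def Sset'' (p : I → k) : Set (I →₀ ℤ) :=
  {v | v ∈ Sset k I p ∧ ∃ i, IsNegInt k (p i) ∧ IsNonnegInt k (p i + ((v i : ℤ) : k))}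

/-- The `k`-span `N` of the `e_v`, `v ∈ S`. -/
def Nspan (p : I → k) (ρ : Weyl k I →ₐ[k] Module.End k ((I →₀ ℤ) →₀ k)) :
    Submodule k (BMod k I ρ) :=
  Submodule.span k {x | ∃ v ∈ Sset k I p, x = eV k I ρ v}

/-- The `k`-span `N''` of the `e_v`, `v ∈ S''`. -/
def Nspan'' (p : I → k) (ρ : Weyl k I →ₐ[k] Module.End k ((I →₀ ℤ) →₀ k)) :
    Submodule k (BMod k I ρ) :=
  Submodule.span k {x | ∃ v ∈ Sset'' k I p, x = eV k I ρ v}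

/-- The weight space of weight `p` in a module over the Weyl algebra:
all `x` with `t i • x = p i • x` for every `i`. -/
def wtSp (M : Type*) [AddCommGroup M] [Module k M] [Module (Weyl k I) M]
    [IsScalarTower k (Weyl k I) M] (p : I → k) : Submodule k M where
  carrier := {x | ∀ i, tA k I i • x = p i • x}
  add_mem' := by
    intro a b ha hb i
    rw [smul_add, ha i, hb i, ← smul_add]
  zero_mem' := by intro i; rw [smul_zero, smul_zero]
  smul_mem' := by
    intro c x hx i
    have h : tA k I i • (c • x) = c • (tA k I i • x) := by
      rw [← algebraMap_smul (Weyl k I) c x, ← algebraMap_smul (Weyl k I) c (tA k I i • x),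
        smul_smul, smul_smul, Algebra.commutes]
    rw [h, hx i, smul_smul, smul_smul, mul_comm]

variable {k I}

lemma Sop_single (i : I) (v : I →₀ ℤ) (c : k) :
    Sop k I i (Finsupp.single v c) = Finsupp.single (v + Finsupp.single i 1) c := by
  simp [Sop, Finsupp.mapDomain_single]

lemma Dop_single (p : I → k) (i : I) (v : I →₀ ℤ) (c : k) :
    Dop k I p i (Finsupp.single v c) =
      Finsupp.single (v - Finsupp.single i 1) ((p i + ((v i : ℤ) : k)) * c) := by
  simp only [Dop, Finsupp.coe_lsum, LinearMap.toSpanSingleton_apply, Finsupp.smul_single,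
    smul_eq_mul, mul_one, Finsupp.sum_single_index, zero_smul, mul_comm c]

lemma Sop_Dop_single (p : I → k) (i : I) (v : I →₀ ℤ) (c : k) :
    Sop k I i (Dop k I p i (Finsupp.single v c)) =
      Finsupp.single v ((p i + ((v i : ℤ) : k)) * c) := by
  rw [Dop_single, Sop_single, sub_add_cancel]

lemma Sop_Dop_apply (p : I → k) (i : I) (x : (I →₀ ℤ) →₀ k) (v : I →₀ ℤ) :
    Sop k I i (Dop k I p i x) v = (p i + ((v i : ℤ) : k)) * x v := by
  classical
  induction x using Finsupp.induction_linear with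
  | zero => simp
  | add x y hx hy => simp only [map_add, Finsupp.add_apply, hx, hy, mul_add]
  | single u c =>
    rw [Sop_Dop_single]
    by_cases h : u = v
    · subst h; simp
    · simp [Finsupp.single_eq_of_ne' h]

/-- A subspace invariant under all `S i` and `D i`. -/
def IsShiftStable (p : I → k) (W : Submodule k ((I →₀ ℤ) →₀ k)) : Prop :=
  ∀ i, ∀ x ∈ W, Sop k I i x ∈ W ∧ Dop k I p i x ∈ W

lemma isShiftStable_supported {p : I → k} {T : Set (I →₀ ℤ)}
    (hup : ∀ v ∈ T, ∀ i, v + Finsupp.single i 1 ∈ T)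
    (hdown : ∀ v ∈ T, ∀ i, p i + ((v i : ℤ) : k) ≠ 0 → v - Finsupp.single i 1 ∈ T) :
    IsShiftStable p (Finsupp.supported k k T) := by
  intro i x hx
  suffices h : Finsupp.supported k k T ≤ (Finsupp.supported k k T).comap (Sop k I i) ⊓
      (Finsupp.supported k k T).comap (Dop k I p i) from h hx
  conv_lhs => rw [Finsupp.supported_eq_span_single]
  rw [Submodule.span_le]
  rintro _ ⟨v, hv, rfl⟩
  refine ⟨?_, ?_⟩
  · simp only [SetLike.mem_coe, Submodule.mem_comap, Sop_single]
    exact Finsupp.single_mem_supported k 1 (hup v hv i)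
  · simp only [SetLike.mem_coe, Submodule.mem_comap, Dop_single]
    by_cases h : p i + ((v i : ℤ) : k) = 0
    · simp [h]
    · exact Finsupp.single_mem_supported k _ (hdown v hv i h)

lemma IsShiftStable.map_mem {p : I → k} {ρ : Weyl k I →ₐ[k] Module.End k ((I →₀ ℤ) →₀ k)}
    (hX : ∀ i, ρ (XA k I i) = Sop k I i) (hY : ∀ i, ρ (YA k I i) = Dop k I p i)
    {W : Submodule k ((I →₀ ℤ) →₀ k)} (hW : IsShiftStable p W) (a : Weyl k I) :
    ∀ x ∈ W, ρ a x ∈ W := by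
  obtain ⟨a, ha⟩ := a
  induction ha using Algebra.adjoin_induction with
  | mem b hb =>
    rcases hb with ⟨i, rfl⟩ | ⟨i, rfl⟩
    · intro x hx
      exact (hX i).symm ▸ (hW i x hx).1
    · intro x hx
      exact (hY i).symm ▸ (hW i x hx).2
  | algebraMap r =>
    intro x hx
    have h : ρ (algebraMap k (Weyl k I) r) x = r • x := by
      rw [AlgHom.commutes, Module.algebraMap_end_apply]
    exact h.symm ▸ W.smul_mem r hx
  | add b c hb hc ihb ihc =>
    intro x hx
    have h := map_add ρ (⟨b, hb⟩ : Weyl k I) ⟨c, hc⟩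
    exact (congrArg (· x) h).symm ▸ W.add_mem (ihb x hx) (ihc x hx)
  | mul b c hb hc ihb ihc =>
    intro x hx
    have h := map_mul ρ (⟨b, hb⟩ : Weyl k I) ⟨c, hc⟩
    exact (congrArg (· x) h).symm ▸ ihb _ (ihc x hx)

/-- A shift-stable subspace as a submodule over the Weyl algebra. -/
def IsShiftStable.toSubmodule {p : I → k} {ρ : Weyl k I →ₐ[k] Module.End k ((I →₀ ℤ) →₀ k)}
    (hX : ∀ i, ρ (XA k I i) = Sop k I i) (hY : ∀ i, ρ (YA k I i) = Dop k I p i)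
    {W : Submodule k ((I →₀ ℤ) →₀ k)} (hW : IsShiftStable p W) :
    Submodule (Weyl k I) (BMod k I ρ) where
  carrier := (W : Set ((I →₀ ℤ) →₀ k))
  add_mem' := W.add_mem
  zero_mem' := W.zero_mem
  smul_mem' a x hx := hW.map_mem hX hY a x hx

lemma isShiftStable_restrictScalars {p : I → k}
    {ρ : Weyl k I →ₐ[k] Module.End k ((I →₀ ℤ) →₀ k)}
    (hX : ∀ i, ρ (XA k I i) = Sop k I i) (hY : ∀ i, ρ (YA k I i) = Dop k I p i)
    (P : Submodule (Weyl k I) (BMod k I ρ)) :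
    IsShiftStable p (P.restrictScalars k : Submodule k (BMod k I ρ)) := by
  intro i x hx
  rw [← hX, ← hY]
  exact ⟨P.smul_mem (XA k I i) hx, P.smul_mem (YA k I i) hx⟩

namespace IsShiftStable

variable {p : I → k} {W : Submodule k ((I →₀ ℤ) →₀ k)}

lemma single_apply_mem [CharZero k] (hW : IsShiftStable p W) {x : (I →₀ ℤ) →₀ k}
    (hx : x ∈ W) (v : I →₀ ℤ) : Finsupp.single v (x v) ∈ W := by
  classical
  induction hn : x.support.card using Nat.strong_induction_on generalizing x with
  | _ n ih =>
    by_cases hu : ∃ u ∈ x.support, u ≠ v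
    · obtain ⟨u, hu, huv⟩ := hu
      obtain ⟨i, hi⟩ : ∃ i, u i ≠ v i := by
        by_contra! h
        exact huv (Finsupp.ext h)
      set y := Sop k I i (Dop k I p i x) - (p i + ((u i : ℤ) : k)) • x with hy
      have hyW : y ∈ W :=
        W.sub_mem (hW i _ (hW i x hx).2).1 (W.smul_mem _ hx)
      have hyw (w : I →₀ ℤ) : y w = (((w i - u i : ℤ)) : k) * x w := by
        simp only [hy, Finsupp.sub_apply, Sop_Dop_apply, Finsupp.smul_apply, smul_eq_mul]
        push_cast
        ring
      have hlt : y.support.card < n := by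
        rw [← hn]
        refine Finset.card_lt_card ((Finset.ssubset_iff_of_subset ?_).2 ⟨u, hu, ?_⟩)
        · intro w hw
          rw [Finsupp.mem_support_iff, hyw] at hw
          exact Finsupp.mem_support_iff.2 (right_ne_zero_of_mul hw)
        · simp [hyw]
      have hne : (((v i - u i : ℤ)) : k) ≠ 0 := by
        rw [Int.cast_ne_zero]
        exact sub_ne_zero.2 hi.symm
      have h := W.smul_mem (((v i - u i : ℤ)) : k)⁻¹ (ih _ hlt hyW rfl)
      rwa [hyw, Finsupp.smul_single, smul_eq_mul, inv_mul_cancel_left₀ hne] at h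
    · push Not at hu
      rwa [← Finsupp.support_subset_singleton.1 (fun u h => Finset.mem_singleton.2 (hu u h))]

lemma single_add_mem (hW : IsShiftStable p W) {u : I →₀ ℤ} (hu : Finsupp.single u 1 ∈ W)
    (i : I) (n : ℕ) : Finsupp.single (u + Finsupp.single i (n : ℤ)) 1 ∈ W := by
  induction n with
  | zero => simpa using hu
  | succ n ih =>
    have h := (hW i _ ih).1
    rwa [Sop_single, add_assoc, ← Finsupp.single_add] at h

lemma single_sub_mem (hW : IsShiftStable p W) {u : I →₀ ℤ} (hu : Finsupp.single u 1 ∈ W)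
    (i : I) (n : ℕ) (hn : ∀ m : ℤ, u i - n < m → m ≤ u i → p i + (m : k) ≠ 0) :
    Finsupp.single (u - Finsupp.single i (n : ℤ)) 1 ∈ W := by
  induction n with
  | zero => simpa using hu
  | succ n ih =>
    have h := (hW i _ (ih fun m h₁ h₂ => hn m (by push_cast; lia) h₂)).2
    have hne := hn (u i - n) (by push_cast; lia) (by lia)
    rw [Dop_single, sub_sub, ← Finsupp.single_add, Finsupp.sub_apply, Finsupp.single_eq_same] at h
    have h' := W.smul_mem (p i + ((u i - n : ℤ) : k))⁻¹ h
    rwa [Finsupp.smul_single, smul_eq_mul, inv_mul_cancel_left₀ hne] at h'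

lemma single_mem_of_path (hW : IsShiftStable p W) {u w : I →₀ ℤ} (hu : Finsupp.single u 1 ∈ W)
    (h : ∀ i, ∀ m : ℤ, w i < m → m ≤ u i → p i + (m : k) ≠ 0) : Finsupp.single w 1 ∈ W := by
  classical
  obtain ⟨s, hs⟩ : ∃ s : Finset I, ∀ i ∉ s, u i = w i :=
    ⟨(u - w).support, fun i hi => by
      rwa [Finsupp.notMem_support_iff, Finsupp.sub_apply, sub_eq_zero] at hi⟩
  induction s using Finset.induction_on generalizing u with
  | empty =>
    obtain rfl : u = w := Finsupp.ext fun i => hs i (Finset.notMem_empty i)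
    exact hu
  | insert i s hi ih =>
    have hval (j : I) : (u + Finsupp.single i (w i - u i)) j = if j = i then w j else u j := by
      by_cases hj : j = i
      · subst hj; simp
      · simp [hj]
    refine ih (u := u + Finsupp.single i (w i - u i)) ?_ ?_ ?_
    · rcases le_total (u i) (w i) with hle | hle
      · obtain ⟨n, hn⟩ := Int.eq_ofNat_of_zero_le (sub_nonneg.2 hle)
        rw [hn]
        exact hW.single_add_mem hu i n
      · obtain ⟨n, hn⟩ := Int.eq_ofNat_of_zero_le (sub_nonneg.2 hle)
        rw [← neg_sub, hn, Finsupp.single_neg, ← sub_eq_add_neg]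
        exact hW.single_sub_mem hu i n fun m h₁ h₂ => h i m (by lia) h₂
    · intro j m h₁ h₂
      rw [hval] at h₂
      split_ifs at h₂ with hj
      · lia
      · exact h j m h₁ h₂
    · intro j hj
      rw [hval]
      split_ifs with hji
      · rfl
      · exact hs j (by simp [hji, hj])

end IsShiftStable

lemma IsNonnegInt.add_one {c : k} (h : IsNonnegInt k c) : IsNonnegInt k (c + 1) := by
  obtain ⟨n, rfl⟩ := h
  exact ⟨n + 1, by push_cast; rfl⟩

lemma IsNonnegInt.sub_one {c : k} (h : IsNonnegInt k c) (hc : c ≠ 0) :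
    IsNonnegInt k (c - 1) := by
  obtain ⟨_ | n, rfl⟩ := h
  · simp at hc
  · exact ⟨n, by push_cast; ring⟩

lemma IsNonnegInt.add_single {p : I → k} {v : I →₀ ℤ} {j : I}
    (h : IsNonnegInt k (p j + ((v j : ℤ) : k))) (i : I) :
    IsNonnegInt k (p j + ((v + Finsupp.single i 1 : I →₀ ℤ) j : k)) := by
  classical
  by_cases hj : j = i
  · subst hj
    simpa [add_assoc] using h.add_one
  · simpa [hj] using h

lemma IsNonnegInt.sub_single {p : I → k} {v : I →₀ ℤ} {j : I}
    (h : IsNonnegInt k (p j + ((v j : ℤ) : k))) {i : I} (hi : p i + ((v i : ℤ) : k) ≠ 0) :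
    IsNonnegInt k (p j + ((v - Finsupp.single i 1 : I →₀ ℤ) j : k)) := by
  classical
  by_cases hj : j = i
  · subst hj
    simpa [add_sub_assoc] using h.sub_one hi
  · simpa [hj] using h

lemma isShiftStable_Sset (p : I → k) :
    IsShiftStable p (Finsupp.supported k k (Sset k I p)) :=
  isShiftStable_supported (fun _ hv i j hj => (hv j hj).add_single i)
    (fun _ hv _ hi j hj => (hv j hj).sub_single hi)

lemma isShiftStable_Sset'' (p : I → k) :
    IsShiftStable p (Finsupp.supported k k (Sset'' k I p)) :=
  isShiftStable_supported
    (fun _ ⟨hv, l, hl, hvl⟩ i => ⟨fun j hj => (hv j hj).add_single i, l, hl, hvl.add_single i⟩)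
    (fun _ ⟨hv, l, hl, hvl⟩ _ hi =>
      ⟨fun j hj => (hv j hj).sub_single hi, l, hl, hvl.sub_single hi⟩)

lemma zero_mem_Sset (p : I → k) : (0 : I →₀ ℤ) ∈ Sset k I p := by
  intro i hi
  simpa using hi

lemma zero_notMem_Sset'' [CharZero k] (p : I → k) : (0 : I →₀ ℤ) ∉ Sset'' k I p := by
  rintro ⟨-, i, ⟨m, hm, hpm⟩, n, hn⟩
  rw [hpm] at hn
  have : m = n := by simpa using (by exact_mod_cast hn : m + (0 : I →₀ ℤ) i = (n : ℤ))
  lia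

lemma add_ne_zero_of_mem_Sset [CharZero k] {p : I → k} {u w : I →₀ ℤ} (hu : u ∈ Sset k I p)
    (hu' : u ∉ Sset'' k I p) (hw : w ∈ Sset k I p) (i : I) (m : ℤ) (hwm : w i < m)
    (hmu : m ≤ u i) : p i + (m : k) ≠ 0 := by
  intro h
  have hp : p i = ((-m : ℤ) : k) := by
    push_cast
    exact eq_neg_of_add_eq_zero_left h
  rcases le_or_gt m 0 with hm | hm
  · obtain ⟨n, hn⟩ := hw i ⟨m.natAbs, by rw [hp, ← Int.cast_natCast]; congr 1; lia⟩
    rw [hp] at hn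
    have : -m + w i = n := by exact_mod_cast hn
    lia
  · refine hu' ⟨hu, i, ⟨-m, by lia, hp⟩, (u i - m).natAbs, ?_⟩
    rw [hp, ← Int.cast_natCast, ← Int.cast_add]
    congr 1
    lia

lemma supported_Sset_le [CharZero k] {p : I → k} {W : Submodule k ((I →₀ ℤ) →₀ k)}
    (hW : IsShiftStable p W) (hle : Finsupp.supported k k (Sset'' k I p) ≤ W)
    {x : (I →₀ ℤ) →₀ k} (hxW : x ∈ W) (hx : x ∈ Finsupp.supported k k (Sset k I p))
    (hx' : x ∉ Finsupp.supported k k (Sset'' k I p)) :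
    Finsupp.supported k k (Sset k I p) ≤ W := by
  rw [Finsupp.mem_supported] at hx hx'
  obtain ⟨u, hux, hu'⟩ := Set.not_subset.1 hx'
  have hu : Finsupp.single u 1 ∈ W := by
    have h := W.smul_mem (x u)⁻¹ (hW.single_apply_mem hxW u)
    rwa [Finsupp.smul_single, smul_eq_mul,
      inv_mul_cancel₀ (Finsupp.mem_support_iff.1 hux)] at h
  rw [Finsupp.supported_eq_span_single, Submodule.span_le]
  rintro _ ⟨w, hw, rfl⟩
  by_cases hw' : w ∈ Sset'' k I p
  · exact hle (Finsupp.single_mem_supported k 1 hw')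
  · exact hW.single_mem_of_path hu (add_ne_zero_of_mem_Sset (hx hux) hu' hw)

lemma span_eV_eq_supported (ρ : Weyl k I →ₐ[k] Module.End k ((I →₀ ℤ) →₀ k))
    (T : Set (I →₀ ℤ)) :
    (Submodule.span k {x | ∃ v ∈ T, x = eV k I ρ v} : Set (BMod k I ρ)) =
      (Finsupp.supported k k T : Set ((I →₀ ℤ) →₀ k)) := by
  rw [Finsupp.supported_eq_span_single]
  have h : {x | ∃ v ∈ T, x = eV k I ρ v} = (fun v => Finsupp.single v (1 : k)) '' T :=
    Set.ext fun x => exists_congr fun v => and_congr_right fun _ => eq_comm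
  rw [h]
  rfl

lemma single_zero_notMem_supported_Sset'' [CharZero k] (p : I → k) :
    (Finsupp.single 0 1 : (I →₀ ℤ) →₀ k) ∉ Finsupp.supported k k (Sset'' k I p) := fun h =>
  zero_notMem_Sset'' p (h (by simp))

lemma tA_smul_eV_zero {p : I → k} {ρ : Weyl k I →ₐ[k] Module.End k ((I →₀ ℤ) →₀ k)}
    (hX : ∀ i, ρ (XA k I i) = Sop k I i) (hY : ∀ i, ρ (YA k I i) = Dop k I p i) (i : I) :
    tA k I i • eV k I ρ 0 = p i • eV k I ρ 0 := by
  have h : ρ (tA k I i) (Finsupp.single 0 1) = p i • Finsupp.single (0 : I →₀ ℤ) (1 : k) := by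
    rw [tA, map_mul, hX, hY, Module.End.mul_apply, Sop_Dop_single]
    simp
  exact h

variable (k I)

/-- `N` and `N''` are submodules of `B(p)` over the Weyl algebra, the
quotient `L(p) = N ⧸ N''` is a simple module, and the image of `e 0` in it is nonzero, so
the weight space of weight `p` of `N ⧸ N''` is nonzero. -/
theorem N_submodules_and_simple_quotient [IsAlgClosed k] [CharZero k] [Infinite I]
    (p : I → k) (ρ : Weyl k I →ₐ[k] Module.End k ((I →₀ ℤ) →₀ k))
    (hX : ∀ i, ρ (XA k I i) = Sop k I i) (hY : ∀ i, ρ (YA k I i) = Dop k I p i) :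
    ∃ NA NA'' : Submodule (Weyl k I) (BMod k I ρ),
      (NA : Set (BMod k I ρ)) = (Nspan k I p ρ : Set (BMod k I ρ)) ∧
      (NA'' : Set (BMod k I ρ)) = (Nspan'' k I p ρ : Set (BMod k I ρ)) ∧
      IsSimpleModule (Weyl k I) (NA ⧸ Submodule.comap NA.subtype NA'') ∧
      (∀ x : NA, (x : BMod k I ρ) = eV k I ρ 0 →
        (Submodule.Quotient.mk x : NA ⧸ Submodule.comap NA.subtype NA'') ≠ 0) ∧
      wtSp k I (NA ⧸ Submodule.comap NA.subtype NA'') p ≠ ⊥ := by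
  have hN : IsShiftStable p (Finsupp.supported k k (Sset k I p)) := isShiftStable_Sset p
  have hN'' : IsShiftStable p (Finsupp.supported k k (Sset'' k I p)) := isShiftStable_Sset'' p
  have hmem : eV k I ρ 0 ∈ hN.toSubmodule hX hY :=
    Finsupp.single_mem_supported k 1 (zero_mem_Sset p)
  have hne (x : hN.toSubmodule hX hY) (hx : (x : BMod k I ρ) = eV k I ρ 0) :
      (Submodule.Quotient.mk x : hN.toSubmodule hX hY ⧸
        Submodule.comap (hN.toSubmodule hX hY).subtype (hN''.toSubmodule hX hY)) ≠ 0 := by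
    rw [Ne, Submodule.Quotient.mk_eq_zero, Submodule.mem_comap, Submodule.subtype_apply, hx]
    exact single_zero_notMem_supported_Sset'' p
  have hle : hN''.toSubmodule hX hY ≤ hN.toSubmodule hX hY :=
    Finsupp.supported_mono (M := k) (R := k) fun v hv => hv.1
  refine ⟨hN.toSubmodule hX hY, hN''.toSubmodule hX hY, (span_eV_eq_supported ρ _).symm,
    (span_eV_eq_supported ρ _).symm, ?_, hne, ?_⟩
  · rw [← covBy_iff_quot_is_simple hle]
    refine ⟨lt_of_le_of_ne hle fun h => single_zero_notMem_supported_Sset'' p (h.ge hmem), ?_⟩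
    intro P hP hPN
    obtain ⟨x, hxP, hx⟩ := SetLike.exists_of_lt hP
    exact hPN.not_ge (supported_Sset_le (isShiftStable_restrictScalars hX hY P) hP.le hxP
      (hPN.le hxP) hx)
  · rw [Submodule.ne_bot_iff]
    refine ⟨Submodule.Quotient.mk ⟨eV k I ρ 0, hmem⟩, fun i => ?_, hne _ rfl⟩
    rw [← Submodule.Quotient.mk_smul, ← Submodule.Quotient.mk_smul]
    exact congrArg _ (Subtype.ext (tA_smul_eV_zero hX hY i))
end
end
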